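/- arXiv:2210.03618 — 2 statements merged into one kernel-verified Lean document; each statement's English description precedes it below -/
import Mathlib

section
/- Let n ≥ 1, let d, ℓ ∈ [1..n] and λ ≥ 1 be integers, and let x ∈ {0,1}^n have exactly n − d one-bits. Generate λ independent offspring x_1, …, x_λ, each obtained by choosing a uniformly random ℓ-element subset of the n positions and flipping the bits of x at those positions. Then the probability that at least one x_i has strictly more than n − d − ℓ one-bits is at least 1 − (1 − d/n)^{ℓλ}. -/
open scoped ENNReal
attribute [local instance] Classical.propDecidable

namespace GSEMO

noncomputable section

/-- Bit strings of length `n`. -/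
abbrev BitString (n : ℕ) := Fin n → Bool

/-- The number of one-bits of a bit string. -/
def oneCount {n : ℕ} (x : BitString n) : ℕ :=
  (Finset.univ.filter fun i => x i = true).card

/-- Flip the bits of `x` at the positions in `S`. -/
def flipSet {n : ℕ} (x : BitString n) (S : Finset (Fin n)) : BitString n :=
  fun i => if i ∈ S then !(x i) else x i

/-- A list of `m` independent samples from `p`. -/
def iid {α : Type*} (p : PMF α) : ℕ → PMF (List α)
  | 0 => PMF.pure []
  | m + 1 => p.bind fun a => (iid p m).bind fun L => PMF.pure (a :: L)

/-- A uniformly random subset of `Fin n` of cardinality `ℓ`. -/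
def uniformSubsetsOfCard (n ℓ : ℕ) : PMF (Finset (Fin n)) :=
  if h : ((Finset.univ : Finset (Fin n)).powersetCard ℓ).Nonempty
  then PMF.uniformOfFinset _ h else PMF.pure ∅

/-- A mutation offspring of `x`: flip a uniformly random set of exactly `ℓ` bits of `x`. -/
def mutationOffspring {n : ℕ} (x : BitString n) (ℓ : ℕ) : PMF (BitString n) :=
  (uniformSubsetsOfCard n ℓ).map (flipSet x)

theorem iid_all_le {α : Type*} (p : PMF α) (B : Set α) (m : ℕ) :
    (iid p m).toOuterMeasure {L | ∀ y ∈ L, y ∈ B} ≤ (p.toOuterMeasure B) ^ m := by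
  induction m with
  | zero =>
    simp [iid]
  | succ m ih =>
    rw [iid, PMF.toOuterMeasure_bind_apply, pow_succ']
    refine le_trans ?_ (mul_le_mul_right ih _)
    rw [PMF.toOuterMeasure_apply p B,
      ← ENNReal.tsum_mul_right]
    refine ENNReal.tsum_le_tsum fun a => ?_
    by_cases ha : a ∈ B
    · rw [Set.indicator_of_mem ha]
      refine mul_le_mul_right ?_ _
      refine le_of_eq ?_
      rw [PMF.toOuterMeasure_bind_apply, PMF.toOuterMeasure_apply]
      refine tsum_congr fun L => ?_
      rw [PMF.toOuterMeasure_pure_apply]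
      by_cases hL : ∀ y ∈ L, y ∈ B
      · rw [Set.indicator_of_mem (by exact hL), if_pos (by simpa using ⟨ha, hL⟩), mul_one]
      · rw [Set.indicator_of_notMem (by exact hL), if_neg, mul_zero]
        intro h
        exact hL fun y hy => h y (List.mem_cons_of_mem _ hy)
    · rw [Set.indicator_of_notMem ha, zero_mul]
      refine le_of_eq ?_
      rw [PMF.toOuterMeasure_bind_apply]
      refine mul_eq_zero_of_right _ ?_
      rw [ENNReal.tsum_eq_zero]
      intro L
      rw [PMF.toOuterMeasure_pure_apply, if_neg, mul_zero]
      intro h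
      exact ha (h a List.mem_cons_self)

theorem descFactorial_mul_pow_le (m n k : ℕ) (hmn : m ≤ n) :
    m.descFactorial k * n ^ k ≤ m ^ k * n.descFactorial k := by
  induction k with
  | zero => simp
  | succ k ih =>
    rw [Nat.descFactorial_succ, Nat.descFactorial_succ, pow_succ, pow_succ]
    have h : (m - k) * n ≤ m * (n - k) := by
      rw [Nat.sub_mul, Nat.mul_sub]
      have : m * k ≤ k * n := by rw [mul_comm]; exact Nat.mul_le_mul_left _ hmn
      omega
    calc _ = ((m - k) * n) * (m.descFactorial k * n ^ k) := by ring
      _ ≤ (m * (n - k)) * (m ^ k * n.descFactorial k) := Nat.mul_le_mul h ih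
      _ = _ := by ring

theorem choose_mul_pow_le (m n k : ℕ) (hmn : m ≤ n) :
    m.choose k * n ^ k ≤ m ^ k * n.choose k := by
  have h := descFactorial_mul_pow_le m n k hmn
  rw [Nat.descFactorial_eq_factorial_mul_choose, Nat.descFactorial_eq_factorial_mul_choose] at h
  refine Nat.le_of_mul_le_mul_left ?_ (Nat.factorial_pos k)
  calc _ = _ := by rw [← mul_assoc]
    _ ≤ _ := h
    _ = _ := by ring

theorem subset_of_bad {n : ℕ} (x : BitString n) (S : Finset (Fin n))
    (h : oneCount (flipSet x S) + S.card ≤ oneCount x) :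
    S ⊆ Finset.univ.filter fun i => x i = true := by
  have h1 : (Finset.univ.filter fun i => x i = true) \ S ⊆
      (Finset.univ.filter fun i => flipSet x S i = true) := by
    intro i hi
    simp only [Finset.mem_sdiff, Finset.mem_filter, Finset.mem_univ, true_and] at hi
    simp [flipSet, hi.1, hi.2]
  have h2 := Finset.card_le_card h1
  have h3 := Finset.card_sdiff_add_card_inter (Finset.univ.filter fun i => x i = true) S
  unfold oneCount at h
  have h4 : S.card ≤ ((Finset.univ.filter fun i => x i = true) ∩ S).card := by omega
  have h5 := Finset.eq_of_subset_of_card_le Finset.inter_subset_right h4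
  rw [← h5]
  exact Finset.inter_subset_left

theorem single_bad (n d ℓ : ℕ) (hn : 1 ≤ n) (hdn : d ≤ n) (hln : ℓ ≤ n)
    (x : BitString n) (hx : oneCount x = n - d) :
    (mutationOffspring x ℓ).toOuterMeasure
      {y | ¬ ((n : ℤ) - d - ℓ < (oneCount y : ℤ))} ≤
      (1 - (d : ℝ≥0∞) / (n : ℝ≥0∞)) ^ ℓ := by
  have hne : ((Finset.univ : Finset (Fin n)).powersetCard ℓ).Nonempty := by
    rw [Finset.powersetCard_nonempty]; simpa using hln
  have hn0 : (n : ℝ≥0∞) ≠ 0 := by exact_mod_cast (by omega : n ≠ 0)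
  have hq : 1 - (d : ℝ≥0∞) / (n : ℝ≥0∞) = ((n - d : ℕ) : ℝ≥0∞) / n := by
    rw [← ENNReal.div_self hn0 (ENNReal.natCast_ne_top n), ENNReal.natCast_sub,
      ENNReal.sub_div (fun _ _ => hn0)]
  rw [mutationOffspring, PMF.toOuterMeasure_map_apply, uniformSubsetsOfCard, dif_pos hne,
    PMF.toOuterMeasure_uniformOfFinset_apply, hq, div_eq_mul_inv ((n - d : ℕ) : ℝ≥0∞), mul_pow,
    ← ENNReal.inv_pow, ← div_eq_mul_inv]
  have hcard : (((Finset.univ : Finset (Fin n)).powersetCard ℓ).filter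
      (· ∈ flipSet x ⁻¹' {y | ¬ ((n : ℤ) - d - ℓ < (oneCount y : ℤ))})).card
      ≤ (n - d).choose ℓ := by
    rw [← hx, oneCount, ← Finset.card_powersetCard]
    refine Finset.card_le_card fun S hS => ?_
    simp only [Finset.mem_filter, Finset.mem_powersetCard, Set.mem_preimage,
      Set.mem_setOf_eq, not_lt] at hS
    rw [Finset.mem_powersetCard]
    refine ⟨subset_of_bad x S ?_, hS.1.2⟩
    have := hS.1.2
    have := hS.2
    omega
  have hc : 0 < n.choose ℓ := Nat.choose_pos hln
  rw [Finset.card_powersetCard, Finset.card_univ, Fintype.card_fin]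
  refine ENNReal.div_le_of_le_mul ?_
  rw [mul_comm, ← mul_div_assoc]
  rw [ENNReal.le_div_iff_mul_le (Or.inl (pow_ne_zero _ hn0))
    (Or.inl (ENNReal.pow_ne_top (ENNReal.natCast_ne_top n)))]
  have := choose_mul_pow_le (n - d) n ℓ (Nat.sub_le _ _)
  have h2 := (Nat.mul_le_mul_right (n ^ ℓ) hcard).trans this
  rw [mul_comm ((n - d) ^ ℓ)] at h2
  exact_mod_cast h2

/-- **Lemma 1 of the paper.** Let `d, ℓ ∈ [1..n]`, `λ ≥ 1`, and let `x` have exactly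
`n − d` one-bits. Generate `λ` independent offspring, each by flipping a uniformly random
set of exactly `ℓ` bits of `x`. Then the probability that at least one offspring has
strictly more than `n − d − ℓ` one-bits is at least `1 − (1 − d/n)^(ℓλ)`. -/
theorem mutation_success_prob_ge (n d ℓ lam : ℕ) (hn : 1 ≤ n)
    (hd1 : 1 ≤ d) (hdn : d ≤ n) (hl1 : 1 ≤ ℓ) (hln : ℓ ≤ n) (hlam : 1 ≤ lam)
    (x : BitString n) (hx : oneCount x = n - d) :
    1 - (1 - (d : ℝ≥0∞) / (n : ℝ≥0∞)) ^ (ℓ * lam) ≤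
      (iid (mutationOffspring x ℓ) lam).toOuterMeasure
        {L | ∃ y ∈ L, (n : ℤ) - d - ℓ < (oneCount y : ℤ)} := by
  rw [tsub_le_iff_right]
  set P := iid (mutationOffspring x ℓ) lam with hP
  set A : Set (List (BitString n)) := {L | ∃ y ∈ L, (n : ℤ) - d - ℓ < (oneCount y : ℤ)} with hA
  have hAc : Aᶜ = {L | ∀ y ∈ L, y ∈ {y : BitString n | ¬ ((n : ℤ) - d - ℓ < (oneCount y : ℤ))}} := by
    ext L
    simp [hA]
  have h1 : P.toOuterMeasure Set.univ = 1 := by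
    rw [PMF.toOuterMeasure_apply_eq_one_iff]; exact Set.subset_univ _
  have h2 : P.toOuterMeasure Aᶜ ≤ (1 - (d : ℝ≥0∞) / (n : ℝ≥0∞)) ^ (ℓ * lam) := by
    rw [hAc, pow_mul]
    exact (iid_all_le _ _ lam).trans (pow_le_pow_left' (single_bad n d ℓ hn hdn hln x hx) lam)
  calc (1 : ℝ≥0∞) = P.toOuterMeasure (A ∪ Aᶜ) := by rw [Set.union_compl_self, h1]
    _ ≤ P.toOuterMeasure A + P.toOuterMeasure Aᶜ := MeasureTheory.measure_union_le _ _
    _ ≤ _ := by gcongr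

end

end GSEMO
end

section
/- For every integer n ≥ 1 and every real m > 0, the sum S = Σ_{i=1}^{n} (1 − (1 − i/n)^m)^{−1} satisfies S ≤ (2n/m)·(1 + ln n) + (e/(e−1))·n. In particular, S = O(n·log(n)/m + n). -/
/-- Termwise bound: `(1 - (1-x)^m)⁻¹ ≤ 1 + 1/(m x)` for `0 < x ≤ 1`. -/
theorem term_bound_aux (x m : ℝ) (hx : 0 < x) (hx1 : x ≤ 1) (hm : 0 < m) :
    (1 - (1 - x) ^ m)⁻¹ ≤ 1 + (m * x)⁻¹ := by
  have ht : 0 < m * x := mul_pos hm hx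
  have h1 : (1 - x) ^ m ≤ Real.exp (-(m * x)) := by
    have h := Real.rpow_le_rpow (by linarith) (Real.one_sub_le_exp_neg x) hm.le
    rw [← Real.exp_mul] at h
    convert h using 2
    ring
  have h2 : Real.exp (-(m * x)) ≤ (1 + m * x)⁻¹ := by
    rw [Real.exp_neg]
    apply inv_anti₀ (by positivity)
    linarith [Real.add_one_le_exp (m * x)]
  have h3 : m * x / (1 + m * x) ≤ 1 - (1 - x) ^ m := by
    have : m * x / (1 + m * x) = 1 - (1 + m * x)⁻¹ := by field_simp; ring
    linarith
  have h4 := inv_anti₀ (by positivity) h3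
  have h5 : (m * x / (1 + m * x))⁻¹ = 1 + (m * x)⁻¹ := by field_simp; ring
  linarith

/-- **Key summation estimate (equation (2)) in the proof of Theorem 1 of the paper.**
For every integer `n ≥ 1` and every real `m > 0`,
`Σ_{i=1}^{n} (1 − (1 − i/n)^m)⁻¹ ≤ (2n/m)·(1 + ln n) + (e/(e−1))·n`,
where the power is the real power. -/
theorem sum_inv_one_sub_rpow_le (n : ℕ) (hn : 1 ≤ n) (m : ℝ) (hm : 0 < m) :
    ∑ i ∈ Finset.Icc 1 n, (1 - (1 - (i : ℝ) / (n : ℝ)) ^ m)⁻¹ ≤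
      (2 * (n : ℝ) / m) * (1 + Real.log n) +
        (Real.exp 1 / (Real.exp 1 - 1)) * (n : ℝ) := by
  have hn0 : (0 : ℝ) < n := by exact_mod_cast hn
  have hs : ∑ i ∈ Finset.Icc 1 n, (1 - (1 - (i : ℝ) / (n : ℝ)) ^ m)⁻¹ ≤
      ∑ i ∈ Finset.Icc 1 n, (1 + (n / m) * (i : ℝ)⁻¹) := by
    apply Finset.sum_le_sum
    intro i hi
    rw [Finset.mem_Icc] at hi
    have hi0 : (0 : ℝ) < i := by exact_mod_cast hi.1
    have hin : (i : ℝ) ≤ n := by exact_mod_cast hi.2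
    have h := term_bound_aux ((i : ℝ) / n) m (by positivity) ((div_le_one hn0).2 hin) hm
    have h5 : (m * ((i : ℝ) / n))⁻¹ = (n / m) * (i : ℝ)⁻¹ := by field_simp
    linarith
  have hh := harmonic_le_one_add_log n
  rw [harmonic_eq_sum_Icc] at hh
  push_cast at hh
  rw [Finset.sum_add_distrib, ← Finset.mul_sum] at hs
  simp only [Finset.sum_const, Nat.card_Icc, nsmul_eq_mul, mul_one, Nat.add_sub_cancel] at hs
  have hl : 0 ≤ Real.log n := Real.log_natCast_nonneg n
  have hnm : 0 < (n : ℝ) / m := by positivity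
  have h6 := mul_le_mul_of_nonneg_left hh hnm.le
  have h7 : 0 ≤ (n : ℝ) / m * (1 + Real.log n) := by positivity
  have h8 : 1 ≤ Real.exp 1 / (Real.exp 1 - 1) := by
    have := Real.add_one_le_exp (1 : ℝ)
    rw [le_div_iff₀ (by linarith)]
    linarith
  have h9 := mul_le_mul_of_nonneg_right h8 hn0.le
  have h10 : 2 * (n : ℝ) / m * (1 + Real.log n) = 2 * ((n : ℝ) / m * (1 + Real.log n)) := by ring
  linarith
end
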